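/- Let p ≥ 2, let a, b ≥ 1 be integers with a + b = p, and let m, n ≥ 1 be integers with p² ∣ m and n > a·b·m / p²; set t = a·b·m / p² (an integer since p² ∣ m). Then the adjacency matrix of K_{m,n} (on m + n vertices) has the same characteristic polynomial as the Hermitian adjacency matrix of C₃(n − t, a·m/p, b·m/p) ∪ t·K₁ (also on m + n vertices). In particular, whenever m is divisible by a square p² with p ≥ 2 and n > (p−1)·m/p², the adjacency matrix of K_{m,n} is not determined by its Hermitian spectrum. -/

import Mathlib

open Complex

/-- `H` is the Hermitian adjacency matrix of a mixed graph: Hermitian, zero diagonal,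
entries in `{0, 1, I, -I}`. -/
def IsHermAdj {V : Type*} [Fintype V] (H : Matrix V V ℂ) : Prop :=
  H.IsHermitian ∧ (∀ v, H v v = 0) ∧
    ∀ u v, H u v ∈ ({0, 1, Complex.I, -Complex.I} : Set ℂ)

/-- `M` is determined by its Hermitian spectrum. -/
def IsDHS {V : Type*} [Fintype V] [DecidableEq V] (M : Matrix V V ℂ) : Prop :=
  ∀ H : Matrix V V ℂ, IsHermAdj H → H.charpoly = M.charpoly →
    ∃ σ : Equiv.Perm V, ∃ s : V → ℂ,
      (∀ v, s v ∈ ({1, -1, Complex.I, -Complex.I} : Set ℂ)) ∧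
      ((∀ u v, H u v = s u * (starRingEnd ℂ) (s v) * M (σ u) (σ v)) ∨
       (∀ u v, H u v = s u * (starRingEnd ℂ) (s v) * (starRingEnd ℂ) (M (σ u) (σ v))))

/-- Adjacency matrix of the complete bipartite graph `K_{m,n}`. -/
def Kmn (m n : ℕ) : Matrix (Fin m ⊕ Fin n) (Fin m ⊕ Fin n) ℂ :=
  fun u v =>
    match u, v with
    | Sum.inl _, Sum.inr _ => 1
    | Sum.inr _, Sum.inl _ => 1
    | _, _ => 0

/-- Hermitian adjacency matrix of `C₃(x,y,z) ∪ t·K₁`: the complete tripartite mixed graph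
with parts of sizes `x`, `y`, `z`, all arcs directed cyclically, plus `t` isolated vertices. -/
def triM (x y z t : ℕ) :
    Matrix ((Fin x ⊕ Fin y ⊕ Fin z) ⊕ Fin t) ((Fin x ⊕ Fin y ⊕ Fin z) ⊕ Fin t) ℂ :=
  fun u v =>
    match u, v with
    | Sum.inl (Sum.inl _), Sum.inl (Sum.inr (Sum.inl _)) => Complex.I
    | Sum.inl (Sum.inr (Sum.inl _)), Sum.inl (Sum.inr (Sum.inr _)) => Complex.I
    | Sum.inl (Sum.inr (Sum.inr _)), Sum.inl (Sum.inl _) => Complex.I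
    | Sum.inl (Sum.inr (Sum.inl _)), Sum.inl (Sum.inl _) => -Complex.I
    | Sum.inl (Sum.inr (Sum.inr _)), Sum.inl (Sum.inr (Sum.inl _)) => -Complex.I
    | Sum.inl (Sum.inl _), Sum.inl (Sum.inr (Sum.inr _)) => -Complex.I
    | _, _ => 0

/-- The part of `K_{m,n}` containing a vertex, as a `0/1` incidence matrix. -/
def kPart (m n : ℕ) : Matrix (Fin m ⊕ Fin n) (Fin 2) ℂ :=
  fun u => Sum.elim (fun _ => ![1, 0]) (fun _ => ![0, 1]) u

/-- The part of `C₃(x,y,z) ∪ t·K₁` containing a vertex, as a `0/1` incidence matrix;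
the isolated vertices give zero rows. -/
def triPart (x y z t : ℕ) : Matrix ((Fin x ⊕ Fin y ⊕ Fin z) ⊕ Fin t) (Fin 3) ℂ :=
  fun u => Sum.elim
    (Sum.elim (fun _ => ![1, 0, 0]) (Sum.elim (fun _ => ![0, 1, 0]) (fun _ => ![0, 0, 1])))
    (fun _ => ![0, 0, 0]) u

theorem Kmn_eq_mul (m n : ℕ) :
    Kmn m n = kPart m n * ((!![0, 1; 1, 0] : Matrix _ _ ℂ) * (kPart m n).transpose) := by
  ext u v
  rcases u with u | u <;> rcases v with v | v <;>
    simp [Kmn, kPart, Matrix.mul_apply, Matrix.vecMul, dotProduct, Fin.sum_univ_succ]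

theorem triM_eq_mul (x y z t : ℕ) :
    triM x y z t = triPart x y z t *
      (!![0, I, -I; -I, 0, I; I, -I, 0] * (triPart x y z t).transpose) := by
  ext u v
  rcases u with (u | u | u) | u <;> rcases v with (v | v | v) | v <;>
    simp [triM, triPart, Matrix.mul_apply, Matrix.vecMul, dotProduct, Fin.sum_univ_succ]

theorem kPart_transpose_mul (m n : ℕ) :
    (kPart m n).transpose * kPart m n = !![(m : ℂ), 0; 0, (n : ℂ)] := by
  ext i j
  fin_cases i <;> fin_cases j <;> simp [kPart, Matrix.mul_apply]

theorem triPart_transpose_mul (x y z t : ℕ) :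
    (triPart x y z t).transpose * triPart x y z t =
      !![(x : ℂ), 0, 0; 0, (y : ℂ), 0; 0, 0, (z : ℂ)] := by
  ext i j
  fin_cases i <;> fin_cases j <;> simp [triPart, Matrix.mul_apply]

theorem X_sq_mul_charpoly_Kmn (m n : ℕ) :
    (Polynomial.X : Polynomial ℂ) ^ 2 * (Kmn m n).charpoly =
      Polynomial.X ^ (m + n) * (Polynomial.X ^ 2 - Polynomial.C ((m : ℂ) * n)) := by
  have h := Matrix.charpoly_mul_comm' (kPart m n) ((!![0, 1; 1, 0] : Matrix _ _ ℂ) * (kPart m n).transpose)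
  rw [← Kmn_eq_mul, Matrix.mul_assoc, kPart_transpose_mul] at h
  simp only [Fintype.card_fin, Fintype.card_sum] at h
  rw [h, Matrix.charpoly, Matrix.det_fin_two]
  simp
  ring

theorem X_pow_three_mul_charpoly_triM (x y z t : ℕ) :
    (Polynomial.X : Polynomial ℂ) ^ 3 * (triM x y z t).charpoly =
      Polynomial.X ^ (x + y + z + t) *
        (Polynomial.X ^ 3 - Polynomial.C ((x : ℂ) * y + y * z + z * x) * Polynomial.X) := by
  have h := Matrix.charpoly_mul_comm' (triPart x y z t)
    (!![0, I, -I; -I, 0, I; I, -I, 0] * (triPart x y z t).transpose)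
  rw [← triM_eq_mul, Matrix.mul_assoc, triPart_transpose_mul] at h
  simp only [Fintype.card_fin, Fintype.card_sum, ← add_assoc] at h
  have hI : (Polynomial.C I : Polynomial ℂ) ^ 2 = -1 := by
    rw [← map_pow, I_sq, map_neg, map_one]
  rw [h, Matrix.charpoly, Matrix.det_fin_three]
  simp
  linear_combination (Polynomial.X * ((x : Polynomial ℂ) * y + y * z + z * x)) * hI

theorem charpoly_Kmn_eq_charpoly_triM {m n x y z t : ℕ} (hcard : m + n = x + y + z + t)
    (hprod : m * n = x * y + y * z + z * x) :
    (Kmn m n).charpoly = (triM x y z t).charpoly := by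
  have hprod' : (m : ℂ) * n = x * y + y * z + z * x := by exact_mod_cast hprod
  have hX : (Polynomial.X : Polynomial ℂ) ^ 3 ≠ 0 := pow_ne_zero _ Polynomial.X_ne_zero
  apply mul_left_cancel₀ hX
  rw [X_pow_three_mul_charpoly_triM, ← hcard, ← hprod']
  linear_combination Polynomial.X * X_sq_mul_charpoly_Kmn m n

theorem isHermAdj_triM (x y z t : ℕ) : IsHermAdj (triM x y z t) := by
  refine ⟨?_, ?_, ?_⟩
  · ext u v
    rcases u with (u | u | u) | u <;> rcases v with (v | v | v) | v <;>
      simp [triM, Matrix.conjTranspose_apply]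
  · rintro ((u | u | u) | u) <;> simp [triM]
  · rintro ((u | u | u) | u) ((v | v | v) | v) <;> simp [triM]

theorem IsHermAdj.reindex {V W : Type*} [Fintype V] [Fintype W] {H : Matrix V V ℂ}
    (hH : IsHermAdj H) (e : V ≃ W) : IsHermAdj (Matrix.reindex e e H) :=
  ⟨hH.1.submatrix _, fun _ => hH.2.1 _, fun _ _ => hH.2.2 _ _⟩

/-- `K_{m,n}` has no triangles. -/
theorem Kmn_triangle (m n : ℕ) (u v w : Fin m ⊕ Fin n) :
    Kmn m n u v = 0 ∨ Kmn m n v w = 0 ∨ Kmn m n w u = 0 := by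
  rcases u with u | u <;> rcases v with v | v <;> rcases w with w | w <;> simp [Kmn]

theorem not_isDHS_Kmn {m n x y z t : ℕ} (hx : 0 < x) (hy : 0 < y) (hz : 0 < z)
    (hcard : m + n = x + y + z + t) (hprod : m * n = x * y + y * z + z * x) :
    ¬ IsDHS (Kmn m n) := by
  intro h
  have e : (Fin x ⊕ Fin y ⊕ Fin z) ⊕ Fin t ≃ Fin m ⊕ Fin n :=
    Fintype.equivOfCardEq (by simp [hcard, add_assoc])
  obtain ⟨σ, s, -, hs⟩ := h _ ((isHermAdj_triM x y z t).reindex e)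
    ((Matrix.charpoly_reindex e _).trans (charpoly_Kmn_eq_charpoly_triM hcard hprod).symm)
  have hzero : ∀ u v, Kmn m n (σ (e u)) (σ (e v)) = 0 → triM x y z t u v = 0 := by
    intro u v huv
    rcases hs with hs | hs <;> simpa [huv] using hs (e u) (e v)
  rcases Kmn_triangle m n (σ (e (.inl (.inl ⟨0, hx⟩)))) (σ (e (.inl (.inr (.inl ⟨0, hy⟩)))))
    (σ (e (.inl (.inr (.inr ⟨0, hz⟩))))) with h | h | h <;>
    simpa [triM] using hzero _ _ h

theorem tripartite_sizes {p a b k n : ℕ} (hp : 0 < p) (hab : a + b = p)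
    (hn : a * b * (p ^ 2 * k) / p ^ 2 < n) :
    p ^ 2 * k + n = (n - a * b * (p ^ 2 * k) / p ^ 2) + a * (p ^ 2 * k) / p +
        b * (p ^ 2 * k) / p + a * b * (p ^ 2 * k) / p ^ 2 ∧
      p ^ 2 * k * n = (n - a * b * (p ^ 2 * k) / p ^ 2) * (a * (p ^ 2 * k) / p) +
        (a * (p ^ 2 * k) / p) * (b * (p ^ 2 * k) / p) +
        (b * (p ^ 2 * k) / p) * (n - a * b * (p ^ 2 * k) / p ^ 2) := by
  have ht : a * b * (p ^ 2 * k) / p ^ 2 = a * b * k :=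
    Nat.div_eq_of_eq_mul_right (by positivity) (by ring)
  have hy (c : ℕ) : c * (p ^ 2 * k) / p = c * p * k :=
    Nat.div_eq_of_eq_mul_right hp (by ring)
  rw [ht] at hn
  rw [ht, hy, hy]
  obtain ⟨d, rfl⟩ := Nat.exists_eq_add_of_lt hn
  rw [show a * b * k + d + 1 - a * b * k = d + 1 by omega]
  subst hab
  constructor <;> ring

theorem stmt14 :
    (∀ p a b m n : ℕ, 2 ≤ p → 1 ≤ a → 1 ≤ b → a + b = p → 1 ≤ m → 1 ≤ n →
      p ^ 2 ∣ m → a * b * m / p ^ 2 < n →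
      (Kmn m n).charpoly =
        (triM (n - a * b * m / p ^ 2) (a * m / p) (b * m / p) (a * b * m / p ^ 2)).charpoly) ∧
    (∀ p m n : ℕ, 2 ≤ p → 1 ≤ m → 1 ≤ n → p ^ 2 ∣ m → (p - 1) * m / p ^ 2 < n →
      ¬ IsDHS (Kmn m n)) := by
  constructor
  · rintro p a b m n hp - - hab - - ⟨k, rfl⟩ hn
    obtain ⟨hcard, hprod⟩ := tripartite_sizes (by omega) hab hn
    exact charpoly_Kmn_eq_charpoly_triM hcard hprod
  · rintro p m n hp hm - ⟨k, rfl⟩ hn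
    rw [← one_mul (p - 1)] at hn
    obtain ⟨hcard, hprod⟩ := tripartite_sizes (by omega) (by omega) hn
    have hpos (c : ℕ) (hc : 0 < c) : 0 < c * (p ^ 2 * k) / p := by
      rw [show c * (p ^ 2 * k) = p * (c * p * k) by ring, Nat.mul_div_cancel_left _ (by omega)]
      have hk : 0 < k := Nat.pos_of_mul_pos_left hm
      positivity
    exact not_isDHS_Kmn (Nat.sub_pos_of_lt hn) (hpos _ one_pos) (hpos _ (by omega)) hcard hprod
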